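/- arXiv:1507.02201 — 3 statements merged into one kernel-verified Lean document; each statement's English description precedes it below -/
import Mathlib

section
/- Let t > 0, x₀ ∈ ℝⁿ, and let f, g : ℝⁿ → ℂ be measurable with ∫_{ℝⁿ} |f(x)|² ρ_t^{x₀}(x) dx < ∞ and ∫_{ℝⁿ} |g(x)|² ρ_t^{x₀}(x) dx < ∞, where ρ_t^{x₀}(x) = (2πt)^{-n/2} exp(−‖x−x₀‖²/(2t)). Define the transform A_t f : ℂⁿ → ℂ by A_t f(z) = (2πt)^{-n/2} ∫_{ℝⁿ} exp(−Σ_{j=1}^n (x_j − z_j)²/(2t)) f(x) dx. Then ∫_{ℂⁿ} conj(A_t f(z)) (A_t g)(z) ν(z) dz = ∫_{ℝⁿ} conj(f(x)) g(x) ρ_t^{x₀}(x) dx, where ν(z) = (πt)^{-n} exp(−Σ_{j=1}^n ((Re z_j − (x₀)_j)² + (Im z_j)²)/t) and ℂⁿ is identified with ℝ²ⁿ with Lebesgue measure. -/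
open Real MeasureTheory

section Plancherel

open scoped FourierTransform ContDiff InnerProductSpace SchwartzMap

variable {V : Type*} [NormedAddCommGroup V] [InnerProductSpace ℝ V] [FiniteDimensional ℝ V]
  [MeasurableSpace V] [BorelSpace V]

/-- The Fourier integral of an `L¹ ∩ L²` function represents its `L²` Fourier transform. -/
theorem fourier_toLp_ae_eq {u : V → ℂ} (hu : Integrable u) (hu2 : MemLp u 2) :
    (𝓕 (hu2.toLp u) : Lp ℂ 2 (volume : Measure V)) =ᵐ[volume] 𝓕 u := by
  have hcont : Continuous (𝓕 u) :=
    VectorFourier.fourierIntegral_continuous Real.continuous_fourierChar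
      (L := innerₗ V) continuous_inner hu
  refine ae_eq_of_integral_contDiff_smul_eq
    ((Lp.memLp _).locallyIntegrable (by norm_num)) hcont.locallyIntegrable fun g hg hgs => ?_
  have hgs' : HasCompactSupport fun x => (g x : ℂ) :=
    hgs.comp_left (g := ((↑) : ℝ → ℂ)) Complex.ofReal_zero
  have hg' : ContDiff ℝ ∞ fun x => (g x : ℂ) := Complex.ofRealCLM.contDiff.comp hg
  let G : 𝓢(V, ℂ) := hgs'.toSchwartzMap hg'
  have hG : ∀ x, G x = (g x : ℂ) := fun x => rfl
  have h1 := congrArg (fun T => T G) (Lp.fourier_toTemperedDistribution_eq (hu2.toLp u))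
  simp only [TemperedDistribution.fourier_apply, Lp.toTemperedDistribution_apply] at h1
  have h2 : ∫ ξ, 𝓕 (G : V → ℂ) ξ • u ξ = ∫ x, G x • 𝓕 u x := by
    simpa using! (VectorFourier.integral_fourierIntegral_smul_eq_flip (L := innerₗ V)
      Real.continuous_fourierChar continuous_inner G.integrable hu)
  have h3 : ∫ x, (𝓕 G) x • (hu2.toLp u) x = ∫ ξ, 𝓕 (G : V → ℂ) ξ • u ξ := by
    refine integral_congr_ae ?_
    filter_upwards [hu2.coeFn_toLp] with x hx
    rw [hx, SchwartzMap.fourier_coe]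
  simp only [← Complex.coe_smul, ← hG]
  rw [← h1, h3, h2]

theorem memLp_two_fourier {u : V → ℂ} (hu : Integrable u) (hu2 : MemLp u 2) :
    MemLp (𝓕 u) 2 :=
  (memLp_congr_ae (fourier_toLp_ae_eq hu hu2)).1 (Lp.memLp _)

/-- Plancherel's theorem on `L¹ ∩ L²`. -/
theorem integral_conj_fourier_mul_fourier {u v : V → ℂ} (hu : Integrable u) (hu2 : MemLp u 2)
    (hv : Integrable v) (hv2 : MemLp v 2) :
    ∫ ξ, (starRingEnd ℂ) (𝓕 u ξ) * 𝓕 v ξ = ∫ x, (starRingEnd ℂ) (u x) * v x := by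
  have h := Lp.inner_fourier_eq (hu2.toLp u) (hv2.toLp v)
  rw [L2.inner_def, L2.inner_def] at h
  calc
    _ = ∫ ξ, ⟪(𝓕 (hu2.toLp u) : Lp ℂ 2 (volume : Measure V)) ξ,
        (𝓕 (hv2.toLp v) : Lp ℂ 2 (volume : Measure V)) ξ⟫_ℂ := by
      refine integral_congr_ae ?_
      filter_upwards [fourier_toLp_ae_eq hu hu2, fourier_toLp_ae_eq hv hv2] with x h1 h2
      rw [h1, h2, RCLike.inner_apply, mul_comm]
    _ = _ := h
    _ = _ := by
      refine integral_congr_ae ?_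
      filter_upwards [hu2.coeFn_toLp, hv2.coeFn_toLp] with x h1 h2
      rw [h1, h2, RCLike.inner_apply, mul_comm]

end Plancherel

section ScaledFourier

open scoped FourierTransform

variable {ι : Type*} [Fintype ι]

/-- The Fourier integral on `ι → ℝ` with kernel `exp (i ⟨b, x⟩ / t)`. -/
noncomputable def scaledFourier (t : ℝ) (u : (ι → ℝ) → ℂ) (b : ι → ℝ) : ℂ :=
  ∫ x : ι → ℝ, Complex.exp (Complex.I * (∑ j, (b j : ℂ) * x j) / t) * u x

theorem scaledFourier_eq_fourier (t : ℝ) (u : (ι → ℝ) → ℂ) (b : ι → ℝ) :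
    scaledFourier t u b =
      𝓕 (fun x : EuclideanSpace ℝ ι => u x.ofLp) (WithLp.toLp 2 ((-(2 * π * t))⁻¹ • b)) := by
  rw [Real.fourier_eq', scaledFourier,
    ← (PiLp.volume_preserving_ofLp ι).integral_comp
      (MeasurableEquiv.toLp 2 (ι → ℝ)).symm.measurableEmbedding]
  refine integral_congr_ae (ae_of_all _ fun x => ?_)
  simp only [smul_eq_mul, PiLp.inner_apply, RCLike.inner_apply, conj_trivial, Pi.smul_apply]
  congr 2
  push_cast
  rw [mul_div_assoc, mul_comm, Finset.sum_div, Finset.mul_sum, Finset.sum_mul, Finset.sum_mul]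
  refine Finset.sum_congr rfl fun j _ => ?_
  have : (π : ℂ) ≠ 0 := by exact_mod_cast pi_ne_zero
  rcases eq_or_ne (t : ℂ) 0 with h | h
  · simp [h]
  · field_simp

variable {t : ℝ} {u v : (ι → ℝ) → ℂ}

theorem integrable_comp_ofLp (hu : Integrable u) :
    Integrable fun x : EuclideanSpace ℝ ι => u x.ofLp :=
  (PiLp.volume_preserving_ofLp ι).integrable_comp_of_integrable hu

theorem memLp_comp_ofLp (hu : MemLp u 2) :
    MemLp (fun x : EuclideanSpace ℝ ι => u x.ofLp) 2 :=
  hu.comp_measurePreserving (PiLp.volume_preserving_ofLp ι)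

theorem integrable_conj_scaledFourier_mul (ht : 0 < t) (hu : Integrable u) (hu2 : MemLp u 2)
    (hv : Integrable v) (hv2 : MemLp v 2) :
    Integrable fun b => (starRingEnd ℂ) (scaledFourier t u b) * scaledFourier t v b := by
  simp only [scaledFourier_eq_fourier]
  have hne : (-(2 * π * t))⁻¹ ≠ 0 := inv_ne_zero (neg_ne_zero.2 (by positivity))
  have h := (memLp_two_fourier (integrable_comp_ofLp hu) (memLp_comp_ofLp hu2)).star.integrable_mul
    (memLp_two_fourier (integrable_comp_ofLp hv) (memLp_comp_ofLp hv2))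
  exact (integrable_comp_smul_iff volume _ hne).2
    ((PiLp.volume_preserving_toLp ι).integrable_comp_of_integrable h)

theorem integral_conj_scaledFourier_mul (ht : 0 < t) (hu : Integrable u) (hu2 : MemLp u 2)
    (hv : Integrable v) (hv2 : MemLp v 2) :
    ∫ b, (starRingEnd ℂ) (scaledFourier t u b) * scaledFourier t v b =
      (((2 * π * t) ^ Fintype.card ι : ℝ) : ℂ) * ∫ x, (starRingEnd ℂ) (u x) * v x := by
  simp only [scaledFourier_eq_fourier]
  have h := integral_conj_fourier_mul_fourier (integrable_comp_ofLp hu) (memLp_comp_ofLp hu2)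
    (integrable_comp_ofLp hv) (memLp_comp_ofLp hv2)
  rw [← (PiLp.volume_preserving_toLp ι).integral_comp
      (MeasurableEquiv.toLp 2 (ι → ℝ)).measurableEmbedding,
    (PiLp.volume_preserving_ofLp ι).integral_comp
      (MeasurableEquiv.toLp 2 (ι → ℝ)).symm.measurableEmbedding
      (fun x => (starRingEnd ℂ) (u x) * v x)] at h
  rw [← h, Measure.integral_comp_inv_smul volume (fun b : ι → ℝ =>
    (starRingEnd ℂ) (𝓕 (fun x : EuclideanSpace ℝ ι => u x.ofLp) (WithLp.toLp 2 b)) *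
      𝓕 (fun x : EuclideanSpace ℝ ι => v x.ofLp) (WithLp.toLp 2 b)), abs_pow, abs_neg,
    abs_of_pos (by positivity : 0 < 2 * π * t), Module.finrank_fintype_fun_eq_card,
    Complex.real_smul]

end ScaledFourier

section Gaussian

variable {ι : Type*} [Fintype ι]

/-- The square of the Euclidean distance on `ι → ℝ`. -/
def sqDist (x y : ι → ℝ) : ℝ := ∑ j, (x j - y j) ^ 2

theorem sqDist_nonneg (x y : ι → ℝ) : 0 ≤ sqDist x y :=
  Finset.sum_nonneg fun _ _ => sq_nonneg _

@[fun_prop]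
theorem Continuous.sqDist {X : Type*} [TopologicalSpace X] {F G : X → ι → ℝ}
    (hF : Continuous F) (hG : Continuous G) : Continuous fun p => sqDist (F p) (G p) := by
  unfold _root_.sqDist
  fun_prop

@[fun_prop]
theorem Measurable.sqDist {X : Type*} [MeasurableSpace X] {F G : X → ι → ℝ}
    (hF : Measurable F) (hG : Measurable G) : Measurable fun p => sqDist (F p) (G p) := by
  unfold _root_.sqDist
  fun_prop

theorem sqDist_add_sqDist (a x y : ι → ℝ) :
    sqDist a y + sqDist x a = sqDist x y / 2 + 2 * sqDist a ((1 / 2 : ℝ) • (x + y)) := by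
  simp only [sqDist, Finset.mul_sum, Finset.sum_div, ← Finset.sum_add_distrib]
  refine Finset.sum_congr rfl fun j _ => ?_
  simp only [Pi.smul_apply, Pi.add_apply, smul_eq_mul]
  ring

theorem two_mul_sqDist_midpoint (a x y : ι → ℝ) :
    2 * sqDist a ((1 / 2 : ℝ) • (x + y)) = sqDist x ((2 : ℝ) • a - y) / 2 := by
  simp only [sqDist, Finset.mul_sum, Finset.sum_div]
  refine Finset.sum_congr rfl fun j _ => ?_
  simp only [Pi.smul_apply, Pi.add_apply, Pi.sub_apply, smul_eq_mul]
  ring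

theorem exp_neg_mul_sqDist (c : ℝ) (x y : ι → ℝ) :
    Real.exp (-c * sqDist x y) = ∏ j, Real.exp (-c * (x j - y j) ^ 2) := by
  rw [sqDist, Finset.mul_sum, Real.exp_sum]

theorem integrable_exp_neg_mul_sqDist {c : ℝ} (hc : 0 < c) (y : ι → ℝ) :
    Integrable fun x => Real.exp (-c * sqDist x y) := by
  simp only [exp_neg_mul_sqDist]
  exact Integrable.fintype_prod (f := fun j s => Real.exp (-c * (s - y j) ^ 2))
    fun j => (integrable_exp_neg_mul_sq hc).comp_sub_right (y j)

theorem integral_exp_neg_mul_sqDist (c : ℝ) (y : ι → ℝ) :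
    ∫ x, Real.exp (-c * sqDist x y) = √(π / c) ^ Fintype.card ι := by
  simp only [exp_neg_mul_sqDist]
  rw [integral_fintype_prod_volume_eq_prod (fun j s => Real.exp (-c * (s - y j) ^ 2))]
  simp only [integral_sub_right_eq_self (fun s : ℝ => Real.exp (-c * s ^ 2)), integral_gaussian,
    Finset.prod_const, Finset.card_univ]

end Gaussian

section Window

variable {ι : Type*} [Fintype ι] {t : ℝ} {x₀ : ι → ℝ} {f g h : (ι → ℝ) → ℂ}

/-- The product of `h` with a Gaussian window centered at `a`. -/
noncomputable def gaussianWindow (t : ℝ) (h : (ι → ℝ) → ℂ) (a x : ι → ℝ) : ℂ :=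
  (Real.exp (-sqDist x a / (2 * t)) : ℂ) * h x

theorem measurable_gaussianWindow (hh : Measurable h) :
    Measurable fun p : (ι → ℝ) × (ι → ℝ) => gaussianWindow t h p.1 p.2 := by
  unfold gaussianWindow
  fun_prop

theorem measurable_gaussianWindow_apply (hh : Measurable h) (a : ι → ℝ) :
    Measurable (gaussianWindow t h a) := by
  unfold gaussianWindow
  fun_prop

theorem norm_gaussianWindow (a x : ι → ℝ) :
    ‖gaussianWindow t h a x‖ = Real.exp (-sqDist x a / (2 * t)) * ‖h x‖ := by
  rw [gaussianWindow, norm_mul, Complex.norm_real, Real.norm_of_nonneg (Real.exp_nonneg _)]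

theorem memLp_gaussianWindow (ht : 0 < t) (hm : Measurable h)
    (hh : Integrable fun x => ‖h x‖ ^ 2 * Real.exp (-sqDist x x₀ / (2 * t))) (a : ι → ℝ) :
    MemLp (gaussianWindow t h a) 2 := by
  have hmeas := measurable_gaussianWindow_apply (t := t) hm a
  rw [memLp_two_iff_integrable_sq_norm hmeas.aestronglyMeasurable]
  refine (hh.const_mul (Real.exp (sqDist a x₀ / t))).mono' (by fun_prop) (ae_of_all _ fun x => ?_)
  have hexp : Real.exp (-sqDist x a / (2 * t)) ^ 2 ≤
      Real.exp (sqDist a x₀ / t + -sqDist x x₀ / (2 * t)) := by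
    rw [← Real.exp_nat_mul]
    gcongr
    have h1 : (-sqDist x a) / t ≤ (sqDist a x₀ - sqDist x x₀ / 2) / t := by
      gcongr
      linarith [sqDist_add_sqDist a x x₀, sqDist_nonneg a ((1 / 2 : ℝ) • (x + x₀))]
    calc
      _ = (-sqDist x a) / t := by
        push_cast
        field_simp
      _ ≤ _ := h1
      _ = _ := by ring
  rw [Real.norm_of_nonneg (by positivity), norm_gaussianWindow, mul_pow]
  calc
    _ ≤ Real.exp (sqDist a x₀ / t + -sqDist x x₀ / (2 * t)) * ‖h x‖ ^ 2 := by gcongr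
    _ = _ := by
      rw [Real.exp_add]
      ring

theorem integrable_gaussianWindow (ht : 0 < t) (hm : Measurable h)
    (hh : Integrable fun x => ‖h x‖ ^ 2 * Real.exp (-sqDist x x₀ / (2 * t))) (a : ι → ℝ) :
    Integrable (gaussianWindow t h a) := by
  have hmeas := measurable_gaussianWindow_apply (t := t) hm a
  have hc : 0 < 1 / (2 * t) := by positivity
  refine (hh.add ((integrable_exp_neg_mul_sqDist hc ((2 : ℝ) • a - x₀)).const_mul
    (Real.exp (sqDist a x₀ / t)))).mono' hmeas.aestronglyMeasurable (ae_of_all _ fun x => ?_)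
  rw [norm_gaussianWindow, Pi.add_apply]
  set p := Real.exp (-sqDist x x₀ / (4 * t)) with hp
  set r := Real.exp (-sqDist x a / (2 * t) + sqDist x x₀ / (4 * t)) with hr
  have h1 : Real.exp (-sqDist x a / (2 * t)) = p * r := by
    rw [hp, hr, ← Real.exp_add]
    congr 1
    ring
  have h2 : Real.exp (-sqDist x x₀ / (2 * t)) = p ^ 2 := by
    rw [hp, ← Real.exp_nat_mul]
    congr 1
    push_cast
    field_simp
    ring
  have h3 : Real.exp (sqDist a x₀ / t) *
      Real.exp (-(1 / (2 * t)) * sqDist x ((2 : ℝ) • a - x₀)) = r ^ 2 := by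
    rw [hr, ← Real.exp_nat_mul, ← Real.exp_add]
    congr 1
    have h4 := sqDist_add_sqDist a x x₀
    rw [two_mul_sqDist_midpoint] at h4
    push_cast
    field_simp
    linarith
  rw [h1, h2, h3]
  have : 0 ≤ p * r * ‖h x‖ := by positivity
  nlinarith [sq_nonneg (‖h x‖ * p - r)]

theorem integrable_conj_mul_of_sq {w : (ι → ℝ) → ℝ} (hw : ∀ x, 0 ≤ w x) (hwm : Measurable w)
    (hfm : Measurable f) (hgm : Measurable g)
    (hf : Integrable fun x => ‖f x‖ ^ 2 * w x) (hg : Integrable fun x => ‖g x‖ ^ 2 * w x) :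
    Integrable fun x => (starRingEnd ℂ) (f x) * g x * (w x : ℂ) := by
  refine (hf.add hg).mono' (by fun_prop) (ae_of_all _ fun x => ?_)
  rw [norm_mul, norm_mul, RCLike.norm_conj, Complex.norm_real, Real.norm_of_nonneg (hw x),
    Pi.add_apply, ← add_mul]
  gcongr
  · exact hw x
  nlinarith [sq_nonneg (‖f x‖ - ‖g x‖), mul_nonneg (norm_nonneg (f x)) (norm_nonneg (g x))]

theorem exp_mul_conj_gaussianWindow_mul (ht : 0 < t) (a x : ι → ℝ) :
    (Real.exp (-sqDist a x₀ / t) : ℂ) *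
      ((starRingEnd ℂ) (gaussianWindow t f a x) * gaussianWindow t g a x) =
    (starRingEnd ℂ) (f x) * g x * (Real.exp (-sqDist x x₀ / (2 * t)) : ℂ) *
      (Real.exp (-(2 / t) * sqDist a ((1 / 2 : ℝ) • (x + x₀))) : ℂ) := by
  have h : Real.exp (-sqDist a x₀ / t) *
      (Real.exp (-sqDist x a / (2 * t)) * Real.exp (-sqDist x a / (2 * t))) =
      Real.exp (-sqDist x x₀ / (2 * t)) *
        Real.exp (-(2 / t) * sqDist a ((1 / 2 : ℝ) • (x + x₀))) := by
    simp only [← Real.exp_add]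
    congr 1
    field_simp
    linarith [sqDist_add_sqDist a x x₀]
  have h' := congrArg ((↑) : ℝ → ℂ) h
  simp only [Complex.ofReal_mul] at h'
  simp only [gaussianWindow, map_mul, Complex.conj_ofReal]
  linear_combination ((starRingEnd ℂ) (f x) * g x) * h'

theorem integrable_prod_conj_gaussianWindow_mul
    (hfm : Measurable f) (hgm : Measurable g)
    (hf : Integrable fun x => ‖f x‖ ^ 2 * Real.exp (-sqDist x x₀ / (2 * t)))
    (hg : Integrable fun x => ‖g x‖ ^ 2 * Real.exp (-sqDist x x₀ / (2 * t)))
    (ht : 0 < t) :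
    Integrable fun p : (ι → ℝ) × (ι → ℝ) => (Real.exp (-sqDist p.1 x₀ / t) : ℂ) *
      ((starRingEnd ℂ) (gaussianWindow t f p.1 p.2) * gaussianWindow t g p.1 p.2) := by
  have hc : 0 < 2 / t := by positivity
  simp only [exp_mul_conj_gaussianWindow_mul ht]
  have hmeas : Measurable fun p : (ι → ℝ) × (ι → ℝ) =>
      (starRingEnd ℂ) (f p.2) * g p.2 * (Real.exp (-sqDist p.2 x₀ / (2 * t)) : ℂ) *
        (Real.exp (-(2 / t) * sqDist p.1 ((1 / 2 : ℝ) • (p.2 + x₀))) : ℂ) := by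
    fun_prop
  rw [Measure.volume_eq_prod, integrable_prod_iff' hmeas.aestronglyMeasurable]
  refine ⟨ae_of_all _ fun x => ?_, ?_⟩
  · exact ((integrable_exp_neg_mul_sqDist hc ((1 / 2 : ℝ) • (x + x₀))).ofReal).const_mul
      ((starRingEnd ℂ) (f x) * g x * (Real.exp (-sqDist x x₀ / (2 * t)) : ℂ))
  simp only [norm_mul _ (Complex.ofReal (Real.exp (-(2 / t) * _))), integral_const_mul,
    Complex.norm_real, Real.norm_of_nonneg (Real.exp_nonneg _), integral_exp_neg_mul_sqDist]
  exact (integrable_conj_mul_of_sq (fun _ => (Real.exp_nonneg _)) (by fun_prop)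
    hfm hgm hf hg).norm.mul_const _

theorem integral_integral_conj_gaussianWindow_mul
    (hfm : Measurable f) (hgm : Measurable g)
    (hf : Integrable fun x => ‖f x‖ ^ 2 * Real.exp (-sqDist x x₀ / (2 * t)))
    (hg : Integrable fun x => ‖g x‖ ^ 2 * Real.exp (-sqDist x x₀ / (2 * t)))
    (ht : 0 < t) :
    ∫ a, (Real.exp (-sqDist a x₀ / t) : ℂ) *
      ∫ x, (starRingEnd ℂ) (gaussianWindow t f a x) * gaussianWindow t g a x =
    ((√(π * t / 2) ^ Fintype.card ι : ℝ) : ℂ) *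
      ∫ x, (starRingEnd ℂ) (f x) * g x * (Real.exp (-sqDist x x₀ / (2 * t)) : ℂ) := by
  simp only [← integral_const_mul]
  rw [integral_integral_swap (integrable_prod_conj_gaussianWindow_mul hfm hgm hf hg ht)]
  refine integral_congr_ae (ae_of_all _ fun x => ?_)
  simp only [exp_mul_conj_gaussianWindow_mul ht, integral_const_mul]
  rw [integral_complex_ofReal, integral_exp_neg_mul_sqDist, mul_comm,
    div_div_eq_mul_div]

end Window

section PhaseSpace

variable {ι : Type*} [Fintype ι] {t : ℝ} {x₀ : ι → ℝ} {f g h : (ι → ℝ) → ℂ}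

theorem stronglyMeasurable_scaledFourier_gaussianWindow (hm : Measurable h) :
    StronglyMeasurable fun p : (ι → ℝ) × (ι → ℝ) =>
      scaledFourier t (gaussianWindow t h p.1) p.2 := by
  have hmeas : Measurable fun q : ((ι → ℝ) × (ι → ℝ)) × (ι → ℝ) =>
      Complex.exp (Complex.I * (∑ j, (q.1.2 j : ℂ) * q.2 j) / t) *
        gaussianWindow t h q.1.1 q.2 := by
    unfold gaussianWindow
    fun_prop
  exact hmeas.stronglyMeasurable.integral_prod_right'

theorem integrable_exp_mul_integral_norm_sq_scaledFourier (hfm : Measurable f)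
    (hf : Integrable fun x => ‖f x‖ ^ 2 * Real.exp (-sqDist x x₀ / (2 * t))) (ht : 0 < t) :
    Integrable fun a => Real.exp (-sqDist a x₀ / t) *
      ∫ b, ‖scaledFourier t (gaussianWindow t f a) b‖ ^ 2 := by
  have h1 := (integrable_prod_conj_gaussianWindow_mul hfm hfm hf hf ht).integral_prod_left
  refine ((h1.const_mul (((2 * π * t) ^ Fintype.card ι : ℝ) : ℂ)).re).congr
    (ae_of_all _ fun a => ?_)
  have h2 := integral_conj_scaledFourier_mul ht (integrable_gaussianWindow ht hfm hf a)
    (memLp_gaussianWindow ht hfm hf a) (integrable_gaussianWindow ht hfm hf a)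
    (memLp_gaussianWindow ht hfm hf a)
  have h3 : ∫ b, (starRingEnd ℂ) (scaledFourier t (gaussianWindow t f a) b) *
      scaledFourier t (gaussianWindow t f a) b =
      ((∫ b, ‖scaledFourier t (gaussianWindow t f a) b‖ ^ 2 : ℝ) : ℂ) := by
    simp only [RCLike.conj_mul, ← RCLike.ofReal_pow, integral_ofReal]
    rfl
  simp only [integral_const_mul]
  rw [mul_left_comm, ← h2, h3, ← Complex.ofReal_mul]
  exact RCLike.ofReal_re _

theorem integrable_prod_conj_scaledFourier_mul
    (hfm : Measurable f) (hgm : Measurable g)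
    (hf : Integrable fun x => ‖f x‖ ^ 2 * Real.exp (-sqDist x x₀ / (2 * t)))
    (hg : Integrable fun x => ‖g x‖ ^ 2 * Real.exp (-sqDist x x₀ / (2 * t)))
    (ht : 0 < t) :
    Integrable fun p : (ι → ℝ) × (ι → ℝ) => (Real.exp (-sqDist p.1 x₀ / t) : ℂ) *
      ((starRingEnd ℂ) (scaledFourier t (gaussianWindow t f p.1) p.2) *
        scaledFourier t (gaussianWindow t g p.1) p.2) := by
  have hmf := (stronglyMeasurable_scaledFourier_gaussianWindow (t := t) hfm).measurable
  have hmg := (stronglyMeasurable_scaledFourier_gaussianWindow (t := t) hgm).measurable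
  have hsq : ∀ {u : (ι → ℝ) → ℂ}, Measurable u →
      Integrable (fun x => ‖u x‖ ^ 2 * Real.exp (-sqDist x x₀ / (2 * t))) → ∀ a,
      Integrable fun b => ‖scaledFourier t (gaussianWindow t u a) b‖ ^ 2 := by
    intro u hum hu a
    have h := (integrable_conj_scaledFourier_mul ht (integrable_gaussianWindow ht hum hu a)
      (memLp_gaussianWindow ht hum hu a) (integrable_gaussianWindow ht hum hu a)
      (memLp_gaussianWindow ht hum hu a)).norm
    simpa only [norm_mul, RCLike.norm_conj, ← sq] using h
  have hint : ∀ a, Integrable fun b => (Real.exp (-sqDist a x₀ / t) : ℂ) *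
      ((starRingEnd ℂ) (scaledFourier t (gaussianWindow t f a) b) *
        scaledFourier t (gaussianWindow t g a) b) := fun a =>
    (integrable_conj_scaledFourier_mul ht (integrable_gaussianWindow ht hfm hf a)
      (memLp_gaussianWindow ht hfm hf a) (integrable_gaussianWindow ht hgm hg a)
      (memLp_gaussianWindow ht hgm hg a)).const_mul _
  have hmeas : Measurable fun p : (ι → ℝ) × (ι → ℝ) => (Real.exp (-sqDist p.1 x₀ / t) : ℂ) *
      ((starRingEnd ℂ) (scaledFourier t (gaussianWindow t f p.1) p.2) *
        scaledFourier t (gaussianWindow t g p.1) p.2) := by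
    fun_prop
  rw [Measure.volume_eq_prod, integrable_prod_iff hmeas.aestronglyMeasurable]
  refine ⟨ae_of_all _ hint, ?_⟩
  refine ((integrable_exp_mul_integral_norm_sq_scaledFourier hfm hf ht).add
    (integrable_exp_mul_integral_norm_sq_scaledFourier hgm hg ht)).mono'
    hmeas.norm.stronglyMeasurable.integral_prod_right'.aestronglyMeasurable
    (ae_of_all _ fun a => ?_)
  rw [Real.norm_of_nonneg (integral_nonneg fun _ => norm_nonneg _), Pi.add_apply, ← mul_add,
    ← integral_add (hsq hfm hf a) (hsq hgm hg a), ← integral_const_mul]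
  refine integral_mono (hint a).norm (((hsq hfm hf a).add (hsq hgm hg a)).const_mul _) fun b => ?_
  simp only [norm_mul, RCLike.norm_conj, Complex.norm_real, Real.norm_of_nonneg (Real.exp_nonneg _)]
  gcongr
  nlinarith [sq_nonneg (‖scaledFourier t (gaussianWindow t f a) b‖ -
    ‖scaledFourier t (gaussianWindow t g a) b‖),
    mul_nonneg (norm_nonneg (scaledFourier t (gaussianWindow t f a) b))
      (norm_nonneg (scaledFourier t (gaussianWindow t g a) b))]

theorem integral_prod_conj_scaledFourier_mul
    (hfm : Measurable f) (hgm : Measurable g)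
    (hf : Integrable fun x => ‖f x‖ ^ 2 * Real.exp (-sqDist x x₀ / (2 * t)))
    (hg : Integrable fun x => ‖g x‖ ^ 2 * Real.exp (-sqDist x x₀ / (2 * t)))
    (ht : 0 < t) :
    ∫ p : (ι → ℝ) × (ι → ℝ), (Real.exp (-sqDist p.1 x₀ / t) : ℂ) *
      ((starRingEnd ℂ) (scaledFourier t (gaussianWindow t f p.1) p.2) *
        scaledFourier t (gaussianWindow t g p.1) p.2) =
    (((2 * π * t) ^ Fintype.card ι * √(π * t / 2) ^ Fintype.card ι : ℝ) : ℂ) *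
      ∫ x, (starRingEnd ℂ) (f x) * g x * (Real.exp (-sqDist x x₀ / (2 * t)) : ℂ) := by
  rw [Measure.volume_eq_prod,
    integral_prod _ (integrable_prod_conj_scaledFourier_mul hfm hgm hf hg ht), Complex.ofReal_mul,
    mul_assoc, ← integral_integral_conj_gaussianWindow_mul hfm hgm hf hg ht, ← integral_const_mul]
  refine integral_congr_ae (ae_of_all _ fun a => ?_)
  simp only [integral_const_mul]
  rw [integral_conj_scaledFourier_mul ht (integrable_gaussianWindow ht hfm hf a)
    (memLp_gaussianWindow ht hfm hf a) (integrable_gaussianWindow ht hgm hg a)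
    (memLp_gaussianWindow ht hgm hg a), mul_left_comm]

end PhaseSpace

theorem measurePreserving_re_im {ι : Type*} [Fintype ι] : MeasurePreserving
    (fun z : ι → ℂ => ((fun j => (z j).re, fun j => (z j).im) : (ι → ℝ) × (ι → ℝ))) :=
  (volume_measurePreserving_arrowProdEquivProdArrow ℝ ℝ ι).comp
    (volume_preserving_pi fun _ => Complex.volume_preserving_equiv_real_prod)

theorem measurableEmbedding_re_im {ι : Type*} [Countable ι] :
    MeasurableEmbedding
    (fun z : ι → ℂ => ((fun j => (z j).re, fun j => (z j).im) : (ι → ℝ) × (ι → ℝ))) :=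
  ((MeasurableEquiv.piCongrRight fun _ : ι => Complex.measurableEquivRealProd).trans
    (MeasurableEquiv.arrowProdEquivProdArrow ℝ ℝ ι)).measurableEmbedding

/-- The Segal–Bargmann integral at `z` is a Fourier integral of a Gaussian window. -/
theorem integral_exp_mul_eq_scaledFourier {ι : Type*} [Fintype ι] (t : ℝ)
    (h : (ι → ℝ) → ℂ) (z : ι → ℂ) :
    ∫ x : ι → ℝ, Complex.exp (-(∑ j, ((x j : ℂ) - z j) ^ 2) / (2 * (t : ℂ))) * h x =
      (Real.exp ((∑ j, (z j).im ^ 2) / (2 * t)) : ℂ) *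
        Complex.exp (((-(∑ j, (z j).re * (z j).im) / t : ℝ) : ℂ) * Complex.I) *
        scaledFourier t (gaussianWindow t h fun j => (z j).re) fun j => (z j).im := by
  rw [scaledFourier, ← integral_const_mul]
  refine integral_congr_ae (ae_of_all _ fun x => ?_)
  simp only [gaussianWindow, Complex.ofReal_exp, ← mul_assoc, ← Complex.exp_add]
  congr 2
  have key : -(∑ j, ((x j : ℂ) - z j) ^ 2) = (∑ j, ((z j).im : ℂ) ^ 2)
      - 2 * Complex.I * (∑ j, ((z j).re : ℂ) * (z j).im)
      + 2 * Complex.I * (∑ j, ((z j).im : ℂ) * x j) - ∑ j, ((x j : ℂ) - (z j).re) ^ 2 := by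
    simp only [Finset.mul_sum, ← Finset.sum_neg_distrib, ← Finset.sum_add_distrib,
      ← Finset.sum_sub_distrib]
    refine Finset.sum_congr rfl fun j _ => ?_
    conv_lhs => rw [← Complex.re_add_im (z j)]
    linear_combination (-((z j).im : ℂ) ^ 2) * Complex.I_sq
  rw [key]
  simp only [sqDist]
  push_cast
  ring

/-- Isometry of the Segal–Bargmann transform in the Euclidean case:
for `f, g` measurable and square integrable against the heat kernel
`ρ_t^{x₀}(x) = (2πt)^{-n/2} e^{−‖x−x₀‖²/(2t)}`, and
`A_t h(z) = (2πt)^{-n/2} ∫ e^{−Σⱼ(xⱼ−zⱼ)²/(2t)} h(x) dx`, one has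
`∫_{ℂⁿ} conj(A_t f) (A_t g) ν dz = ∫_{ℝⁿ} conj(f) g ρ_t^{x₀} dx`, where
`ν(z) = (πt)^{-n} e^{−Σⱼ((Re zⱼ − x₀ⱼ)² + (Im zⱼ)²)/t}`. -/
theorem segalBargmann_isometry_euclidean (n : ℕ) (t : ℝ) (ht : 0 < t)
    (x₀ : Fin n → ℝ) (f g : (Fin n → ℝ) → ℂ)
    (hfm : Measurable f) (hgm : Measurable g) :
    let ρ : (Fin n → ℝ) → ℝ := fun x =>
      (2 * π * t) ^ (-(n : ℝ) / 2) * Real.exp (-(∑ j, (x j - x₀ j) ^ 2) / (2 * t))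
    let At : ((Fin n → ℝ) → ℂ) → (Fin n → ℂ) → ℂ := fun h z =>
      (((2 * π * t) ^ (-(n : ℝ) / 2) : ℝ) : ℂ) *
        ∫ x : Fin n → ℝ, Complex.exp (-(∑ j, ((x j : ℂ) - z j) ^ 2) / (2 * (t : ℂ))) * h x
    let ν : (Fin n → ℂ) → ℝ := fun z =>
      (π * t) ^ (-(n : ℝ)) *
        Real.exp (-(∑ j, (((z j).re - x₀ j) ^ 2 + ((z j).im) ^ 2)) / t)
    Integrable (fun x => ‖f x‖ ^ 2 * ρ x) →
    Integrable (fun x => ‖g x‖ ^ 2 * ρ x) →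
    ∫ z : Fin n → ℂ, (starRingEnd ℂ) (At f z) * At g z * ((ν z : ℝ) : ℂ)
      = ∫ x : Fin n → ℝ, (starRingEnd ℂ) (f x) * g x * ((ρ x : ℝ) : ℂ) := by
  intro ρ At ν hf hg
  have hpos : 0 < 2 * π * t := by positivity
  have hc : 0 < (2 * π * t) ^ (-(n : ℝ) / 2) := by positivity
  have hweight : ∀ {u : (Fin n → ℝ) → ℂ}, Integrable (fun x => ‖u x‖ ^ 2 * ρ x) →
      Integrable fun x => ‖u x‖ ^ 2 * Real.exp (-sqDist x x₀ / (2 * t)) := by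
    intro u hu
    refine (hu.const_mul ((2 * π * t) ^ (-(n : ℝ) / 2))⁻¹).congr (ae_of_all _ fun x => ?_)
    simp only [ρ, sqDist]
    field_simp
  have hpoint : ∀ z : Fin n → ℂ, (starRingEnd ℂ) (At f z) * At g z * ((ν z : ℝ) : ℂ) =
      ((((2 * π * t) ^ (-(n : ℝ) / 2)) ^ 2 * (π * t) ^ (-(n : ℝ)) : ℝ) : ℂ) *
        ((Real.exp (-sqDist (fun j => (z j).re) x₀ / t) : ℂ) *
        ((starRingEnd ℂ) (scaledFourier t (gaussianWindow t f fun j => (z j).re)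
          fun j => (z j).im) *
          scaledFourier t (gaussianWindow t g fun j => (z j).re) fun j => (z j).im)) := by
    intro z
    simp only [At, ν, integral_exp_mul_eq_scaledFourier]
    set E := Complex.exp (((-(∑ j, (z j).re * (z j).im) / t : ℝ) : ℂ) * Complex.I) with hE
    have hEE : (starRingEnd ℂ) E * E = 1 := by
      rw [RCLike.conj_mul, hE, Complex.norm_exp_ofReal_mul_I]
      simp
    have hexp : Real.exp (-(∑ j, (((z j).re - x₀ j) ^ 2 + ((z j).im) ^ 2)) / t) *
        Real.exp ((∑ j, (z j).im ^ 2) / (2 * t)) ^ 2 =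
        Real.exp (-sqDist (fun j => (z j).re) x₀ / t) := by
      rw [← Real.exp_nat_mul, ← Real.exp_add, Finset.sum_add_distrib, sqDist]
      congr 1
      push_cast
      field_simp
      ring
    rw [← hexp]
    simp only [map_mul, Complex.conj_ofReal, Complex.ofReal_mul, Complex.ofReal_pow]
    generalize (starRingEnd ℂ) (scaledFourier (ι := Fin n) t _ _) = F
    generalize scaledFourier (ι := Fin n) t _ _ = G
    generalize (Real.exp _ : ℂ) = X
    generalize (Real.exp _ : ℂ) = Y
    generalize (((2 * π * t) ^ (-(n : ℝ) / 2) : ℝ) : ℂ) = C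
    generalize (((π * t) ^ (-(n : ℝ)) : ℝ) : ℂ) = D
    linear_combination (C ^ 2 * D * X ^ 2 * Y * F * G) * hEE
  have hconst : ((2 * π * t) ^ (-(n : ℝ) / 2)) ^ 2 * (π * t) ^ (-(n : ℝ)) *
      ((2 * π * t) ^ n * √(π * t / 2) ^ n) = (2 * π * t) ^ (-(n : ℝ) / 2) := by
    set s := √(2 * π * t) with hs
    have hs0 : 0 < s := Real.sqrt_pos.2 hpos
    have hs2 : 2 * π * t = s ^ 2 := (Real.sq_sqrt hpos.le).symm
    have h1 : (2 * π * t) ^ (-(n : ℝ) / 2) = (s ^ n)⁻¹ := by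
      rw [hs, Real.sqrt_eq_rpow, ← Real.rpow_natCast, ← Real.rpow_mul hpos.le,
        ← Real.rpow_neg hpos.le]
      congr 1
      ring
    have h2 : (π * t) ^ (-(n : ℝ)) = ((s ^ 2 / 2) ^ n)⁻¹ := by
      rw [Real.rpow_neg (by positivity), Real.rpow_natCast, ← hs2]
      congr 2
      ring
    have h3 : √(π * t / 2) = s / 2 := by
      rw [show π * t / 2 = (s / 2) ^ 2 by rw [div_pow, ← hs2]; ring,
        Real.sqrt_sq (by positivity)]
    rw [h1, h2, h3, hs2]
    simp only [div_pow]
    field_simp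
  have hmain := integral_prod_conj_scaledFourier_mul hfm hgm (hweight hf) (hweight hg) ht
  rw [← (measurePreserving_re_im (ι := Fin n)).integral_comp
    (measurableEmbedding_re_im (ι := Fin n)), Fintype.card_fin] at hmain
  simp only [hpoint]
  rw [integral_const_mul, hmain, ← mul_assoc, ← Complex.ofReal_mul, hconst, ← integral_const_mul]
  refine integral_congr_ae (ae_of_all _ fun x => ?_)
  simp only [ρ, sqDist, Complex.ofReal_mul]
  ring
end

section
/- Let f, g : ℝ → ℂ be continuous and 2π-periodic, t > 0 and θ₀ ∈ ℝ. Set ψ = A_t f and φ = A_t g, where A_t f(x + iy) = (1/2π) ∫_{−π}^{π} f(θ) Σ_{n∈ℤ} e^{in(θ−x−iy) − n²t/2} dθ. Then ∫_{−π}^{π} ∫_{ℝ} conj(ψ(x+iy)) φ(x+iy) ν(x,y) dy dx = ∫_{−π}^{π} conj(f(θ)) g(θ) ρ_t^{θ₀}(θ) dθ, where ν(x,y) = (1/(2π√(πt))) e^{−y²/t} Σ_{n∈ℤ} e^{in(x−θ₀) − n²t/4} and ρ_t^{θ₀}(θ) = (1/2π) Σ_{k∈ℤ} e^{ik(θ−θ₀)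 − k²t/2}. -/
open Real MeasureTheory

/-- The Fourier coefficient of `h` on `(-π, π]` at frequency `-m`. -/
noncomputable def circleCoeff (h : ℝ → ℂ) (m : ℤ) : ℂ :=
  ((1 / (2 * π) : ℝ) : ℂ) * ∫ θ in (-π)..π, h θ * Complex.exp (Complex.I * (m : ℂ) * (θ : ℂ))

theorem hasSum_intervalIntegral_of_norm_le {ι : Type*} [Countable ι] {a b : ℝ}
    {F : ι → ℝ → ℂ} {u : ι → ℝ} (hF : ∀ i, Continuous (F i))
    (hle : ∀ i, ∀ x ∈ Set.uIcc a b, ‖F i x‖ ≤ u i) (hu : Summable u) :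
    HasSum (fun i => ∫ x in a..b, F i x) (∫ x in a..b, ∑' i, F i x) := by
  refine intervalIntegral.hasSum_integral_of_dominated_convergence (fun i _ => u i)
    (fun i => (hF i).aestronglyMeasurable)
    (fun i => .of_forall fun x hx => hle i x (Set.uIoc_subset_uIcc hx))
    (.of_forall fun x _ => hu) intervalIntegrable_const
    (.of_forall fun x hx => ?_)
  exact (hu.of_norm_bounded fun i => hle i x (Set.uIoc_subset_uIcc hx)).hasSum

theorem summable_norm_cexp_theta {c : ℝ} (hc : 0 < c) (w : ℂ) :
    Summable fun m : ℤ =>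
      ‖Complex.exp (Complex.I * (m : ℂ) * w - (m : ℂ) ^ 2 * (c : ℂ))‖ := by
  have hτ : 0 < (Complex.I * ((c / π : ℝ) : ℂ)).im := by
    simp only [Complex.mul_im, Complex.I_re, Complex.I_im, Complex.ofReal_re, zero_mul, one_mul,
      zero_add]
    positivity
  refine ((summable_jacobiTheta₂_term_iff (w / (2 * π)) _).2 hτ).norm.congr fun m => ?_
  have hπ : (π : ℂ) ≠ 0 := by exact_mod_cast pi_ne_zero
  rw [jacobiTheta₂_term]
  congr 2
  push_cast
  field_simp
  linear_combination (m : ℂ) ^ 2 * c * Complex.I_sq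

theorem summable_exp_neg_int_sq_mul {c : ℝ} (hc : 0 < c) :
    Summable fun m : ℤ => Real.exp (-(m : ℝ) ^ 2 * c) := by
  refine (summable_norm_cexp_theta hc 0).congr fun m => ?_
  rw [Complex.norm_exp]
  congr 1
  have : ((m : ℂ) ^ 2).re = (m : ℝ) ^ 2 := by norm_cast
  simp [this]

theorem hasSum_sum_mul_cexp_circleCoeff {h : ℝ → ℂ} (hh : Continuous h) {c : ℝ} (hc : 0 < c)
    (z : ℂ) :
    HasSum (fun m : ℤ => circleCoeff h m *
        Complex.exp (-Complex.I * (m : ℂ) * z - (m : ℂ) ^ 2 * (c : ℂ)))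
      (((1 / (2 * π) : ℝ) : ℂ) * ∫ θ in (-π)..π, h θ *
        ∑' m : ℤ, Complex.exp (Complex.I * (m : ℂ) * ((θ : ℂ) - z) - (m : ℂ) ^ 2 * (c : ℂ))) := by
  obtain ⟨C, hC⟩ := isCompact_uIcc.exists_bound_of_continuousOn (s := Set.uIcc (-π) π)
    hh.continuousOn
  have key := (hasSum_intervalIntegral_of_norm_le (a := -π) (b := π)
    (F := fun (m : ℤ) θ => h θ *
      Complex.exp (Complex.I * (m : ℂ) * ((θ : ℂ) - z) - (m : ℂ) ^ 2 * (c : ℂ)))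
    (u := fun m => C * ‖Complex.exp (Complex.I * (m : ℂ) * (-z) - (m : ℂ) ^ 2 * (c : ℂ))‖)
    (fun m => by fun_prop) (fun m x hx => ?_)
    ((summable_norm_cexp_theta hc (-z)).mul_left C)).mul_left ((1 / (2 * π) : ℝ) : ℂ)
  · simp_rw [tsum_mul_left] at key
    refine key.congr_fun ?_
    intro m
    rw [circleCoeff, mul_assoc, ← intervalIntegral.integral_mul_const]
    congr 2
    ext θ
    rw [mul_assoc, ← Complex.exp_add]
    congr 2
    ring
  · rw [norm_mul]
    refine mul_le_mul (hC x hx) (le_of_eq ?_) (norm_nonneg _) ((norm_nonneg _).trans (hC x hx))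
    simp [Complex.norm_exp]

instance : Fact (0 < 2 * π) := ⟨two_pi_pos⟩

theorem circleCoeff_eq_fourierCoeff (F : AddCircle (2 * π) → ℂ) (m : ℤ) :
    circleCoeff (fun θ => F θ) m = fourierCoeff F (-m) := by
  rw [fourierCoeff_eq_intervalIntegral F (-m) (-π), circleCoeff, Complex.real_smul]
  have : -π + 2 * π = π := by ring
  rw [this]
  congr 2
  ext θ
  rw [neg_neg, fourier_coe_apply, smul_eq_mul, mul_comm]
  congr 2
  have hπ : (π : ℂ) ≠ 0 := by exact_mod_cast pi_ne_zero
  push_cast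
  field_simp

theorem hasSum_conj_circleCoeff_mul {f g : ℝ → ℂ} (hf : Continuous f) (hg : Continuous g)
    (hfper : ∀ θ : ℝ, f (θ + 2 * π) = f θ) (hgper : ∀ θ : ℝ, g (θ + 2 * π) = g θ) :
    HasSum (fun m => (starRingEnd ℂ) (circleCoeff f m) * circleCoeff g m)
      (((1 / (2 * π) : ℝ) : ℂ) * ∫ θ in (-π)..π, (starRingEnd ℂ) (f θ) * g θ) := by
  let F : C(AddCircle (2 * π), ℂ) := ⟨Function.Periodic.lift hfper, continuous_coinduced_dom.2 hf⟩
  let G : C(AddCircle (2 * π), ℂ) := ⟨Function.Periodic.lift hgper, continuous_coinduced_dom.2 hg⟩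
  have key := fourierBasis.hasSum_inner_mul_inner
    (ContinuousMap.toLp (E := ℂ) 2 AddCircle.haarAddCircle ℂ F)
    (ContinuousMap.toLp (E := ℂ) 2 AddCircle.haarAddCircle ℂ G)
  rw [ContinuousMap.inner_toLp] at key
  simp_rw [← fourierBasis.repr_apply_apply,
    ← inner_conj_symm (ContinuousMap.toLp (E := ℂ) 2 AddCircle.haarAddCircle ℂ F),
    ← fourierBasis.repr_apply_apply, fourierBasis_repr, fourierCoeff_toLp] at key
  have hF : ∀ m, circleCoeff f m = fourierCoeff F (-m) := circleCoeff_eq_fourierCoeff F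
  have hG : ∀ m, circleCoeff g m = fourierCoeff G (-m) := circleCoeff_eq_fourierCoeff G
  simp_rw [hF, hG]
  have h0 := circleCoeff_eq_fourierCoeff (fun x => G x * (starRingEnd ℂ) (F x)) 0
  rw [fourierCoeff] at h0
  simp only [fourier_zero, neg_zero, one_smul] at h0
  rw [← h0] at key
  convert! (Equiv.neg ℤ).hasSum_iff.2 key using 1
  rw [circleCoeff]
  congr 2
  ext θ
  simp only [Int.cast_zero, mul_zero, zero_mul, Complex.exp_zero, mul_one]
  exact mul_comm _ _

theorem summable_norm_sq_circleCoeff {f : ℝ → ℂ} (hf : Continuous f)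
    (hfper : ∀ θ : ℝ, f (θ + 2 * π) = f θ) :
    Summable fun m => ‖circleCoeff f m‖ ^ 2 := by
  refine (hasSum_conj_circleCoeff_mul hf hf hfper hfper).summable.norm.congr fun m => ?_
  rw [norm_mul, RCLike.norm_conj, sq]

theorem integral_exp_mul_sub_sq_div {t : ℝ} (ht : 0 < t) (s : ℝ) :
    Integrable (fun y : ℝ => Real.exp (s * y - y ^ 2 / t)) ∧
    ∫ y : ℝ, Real.exp (s * y - y ^ 2 / t) = √(π * t) * Real.exp (s ^ 2 * t / 4) := by
  have h : (fun y : ℝ => Real.exp (s * y - y ^ 2 / t)) = fun y =>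
      (fun y => Real.exp (-(1 / t) * y ^ 2)) (y - s * t / 2) * Real.exp (s ^ 2 * t / 4) := by
    ext y
    simp only
    rw [← Real.exp_add]
    congr 1
    field_simp
    ring
  rw [h]
  refine ⟨((integrable_exp_neg_mul_sq (by positivity)).comp_sub_right _).mul_const _, ?_⟩
  rw [integral_mul_const, integral_sub_right_eq_self (fun y => Real.exp (-(1 / t) * y ^ 2)),
    integral_gaussian]
  simp

theorem integral_cexp_int_mul (m : ℤ) :
    ∫ x in (-π)..π, Complex.exp (Complex.I * (m : ℂ) * (x : ℂ)) =
      if m = 0 then (2 * π : ℂ) else 0 := by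
  rcases eq_or_ne m 0 with rfl | hm
  · simp [two_mul]
  · have hm' : Complex.I * (m : ℂ) ≠ 0 := by simp [hm]
    rw [integral_exp_mul_complex hm', if_neg hm,
      (Complex.exp_eq_exp_iff_exists_int (x := Complex.I * m * (π : ℝ))).2 ⟨m, ?_⟩, sub_self,
      zero_div]
    push_cast
    ring

theorem circleCoeff_mul_cexp (g : ℝ → ℂ) (k m : ℤ) :
    circleCoeff (fun θ => g θ * Complex.exp (Complex.I * (k : ℂ) * (θ : ℂ))) m =
      circleCoeff g (m + k) := by
  simp only [circleCoeff, mul_assoc, ← Complex.exp_add]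
  congr 3
  ext θ
  congr 2
  push_cast
  ring

theorem hasSum_conj_circleCoeff_mul_shift {f g : ℝ → ℂ} (hf : Continuous f) (hg : Continuous g)
    (hfper : ∀ θ : ℝ, f (θ + 2 * π) = f θ) (hgper : ∀ θ : ℝ, g (θ + 2 * π) = g θ) (k : ℤ) :
    HasSum (fun m => (starRingEnd ℂ) (circleCoeff f m) * circleCoeff g (m + k))
      (circleCoeff (fun θ => (starRingEnd ℂ) (f θ) * g θ) k) := by
  have h := hasSum_conj_circleCoeff_mul hf
    (g := fun θ => g θ * Complex.exp (Complex.I * (k : ℂ) * (θ : ℂ))) (by fun_prop) hfper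
    (fun θ => by
      rw [hgper, Complex.exp_eq_exp_iff_exists_int.2 ⟨k, ?_⟩]
      push_cast
      ring)
  simp_rw [circleCoeff_mul_cexp, ← mul_assoc] at h
  exact h

/-- The shear `(m, j) ↦ (m, m + j)` of `ℤ × ℤ`. -/
def intShear : ℤ × ℤ ≃ ℤ × ℤ := Equiv.prodShear (Equiv.refl ℤ) Equiv.addLeft

@[simp]
theorem intShear_apply (m j : ℤ) : intShear (m, j) = (m, m + j) := rfl

theorem summable_add_mul_exp_neg_sub_sq {α β : ℤ → ℝ} (hα : Summable α) (hβ : Summable β)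
    (hα0 : 0 ≤ α) (hβ0 : 0 ≤ β) {c : ℝ} (hc : 0 < c) :
    Summable fun p : ℤ × ℤ => (α p.1 + β p.2) * Real.exp (-((p.1 : ℝ) - p.2) ^ 2 * c) := by
  have aux : ∀ γ : ℤ → ℝ, Summable γ → 0 ≤ γ →
      Summable fun p : ℤ × ℤ => γ p.1 * Real.exp (-((p.1 : ℝ) - p.2) ^ 2 * c) := by
    intro γ hγ hγ0
    rw [← intShear.summable_iff]
    refine (hγ.mul_of_nonneg (summable_exp_neg_int_sq_mul hc) hγ0
      fun _ => (Real.exp_pos _).le).congr fun p => ?_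
    obtain ⟨m, j⟩ := p
    simp
  simp_rw [add_mul]
  refine (aux α hα hα0).add ?_
  rw [← (Equiv.prodComm ℤ ℤ).summable_iff]
  refine (aux β hβ hβ0).congr fun p => ?_
  simp only [Function.comp_apply, Equiv.prodComm_apply, Prod.fst_swap, Prod.snd_swap]
  rw [← neg_sub (p.1 : ℝ), neg_sq]

/-- The term of index `((m, n), k)` in the expansion of `conj ψ * φ * ν`, integrated over `y`. -/
noncomputable def tripleTerm (a b : ℤ → ℂ) (t θ₀ : ℝ) (p : (ℤ × ℤ) × ℤ) (x : ℝ) : ℂ :=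
  ((1 / (2 * π) : ℝ) : ℂ) * ((starRingEnd ℂ) (a p.1.1) * b p.1.2) *
    Complex.exp (Complex.I * ((p.1.1 - p.1.2 + p.2 : ℤ) : ℂ) * (x : ℂ) +
      (-((p.1.1 : ℂ) - p.1.2) ^ 2 * (t / 4 : ℝ) - (p.2 : ℂ) ^ 2 * (t / 4 : ℝ) -
        Complex.I * (p.2 : ℂ) * (θ₀ : ℂ)))

theorem norm_tripleTerm_le (a b : ℤ → ℂ) (t θ₀ : ℝ) (p : (ℤ × ℤ) × ℤ) (x : ℝ) :
    ‖tripleTerm a b t θ₀ p x‖ ≤ (‖a p.1.1‖ ^ 2 + ‖b p.1.2‖ ^ 2) *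
      Real.exp (-((p.1.1 : ℝ) - p.1.2) ^ 2 * (t / 4)) * Real.exp (-(p.2 : ℝ) ^ 2 * (t / 4)) := by
  have hexp : (Complex.I * ((p.1.1 - p.1.2 + p.2 : ℤ) : ℂ) * (x : ℂ) +
      (-((p.1.1 : ℂ) - p.1.2) ^ 2 * (t / 4 : ℝ) - (p.2 : ℂ) ^ 2 * (t / 4 : ℝ) -
        Complex.I * (p.2 : ℂ) * (θ₀ : ℂ))) =
      ((-((p.1.1 : ℝ) - p.1.2) ^ 2 * (t / 4) + -(p.2 : ℝ) ^ 2 * (t / 4) : ℝ) : ℂ) +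
      (((p.1.1 - p.1.2 + p.2 : ℤ) * x - p.2 * θ₀ : ℝ) : ℂ) * Complex.I := by
    push_cast
    ring
  have hπ : ‖((1 / (2 * π) : ℝ) : ℂ)‖ ≤ 1 := by
    rw [Complex.norm_real, Real.norm_of_nonneg (by positivity), div_le_one (by positivity)]
    linarith [pi_gt_three]
  rw [tripleTerm, hexp, Complex.exp_add, ← Complex.ofReal_exp, norm_mul, norm_mul, norm_mul,
    norm_mul, Complex.norm_exp_ofReal_mul_I, Complex.norm_real (Real.exp _),
    Real.norm_of_nonneg (Real.exp_pos _).le,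
    mul_one, Real.exp_add, ← mul_assoc, RCLike.norm_conj]
  gcongr
  calc ‖((1 / (2 * π) : ℝ) : ℂ)‖ * (‖a p.1.1‖ * ‖b p.1.2‖)
      ≤ 1 * (‖a p.1.1‖ * ‖b p.1.2‖) := by gcongr
    _ ≤ ‖a p.1.1‖ ^ 2 + ‖b p.1.2‖ ^ 2 := by
      nlinarith [sq_nonneg (‖a p.1.1‖ - ‖b p.1.2‖), sq_nonneg ‖a p.1.1‖, sq_nonneg ‖b p.1.2‖]

theorem summable_tripleTerm_bound {a b : ℤ → ℂ} (ha : Summable fun m => ‖a m‖ ^ 2)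
    (hb : Summable fun m => ‖b m‖ ^ 2) {t : ℝ} (ht : 0 < t) :
    Summable fun p : (ℤ × ℤ) × ℤ => (‖a p.1.1‖ ^ 2 + ‖b p.1.2‖ ^ 2) *
      Real.exp (-((p.1.1 : ℝ) - p.1.2) ^ 2 * (t / 4)) * Real.exp (-(p.2 : ℝ) ^ 2 * (t / 4)) :=
  (summable_add_mul_exp_neg_sub_sq ha hb (fun _ => sq_nonneg _) (fun _ => sq_nonneg _)
    (by positivity)).mul_of_nonneg (summable_exp_neg_int_sq_mul (by positivity))
    (fun _ => by dsimp; positivity) (fun _ => (Real.exp_pos _).le)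

theorem integral_tripleTerm (a b : ℤ → ℂ) (t θ₀ : ℝ) (p : (ℤ × ℤ) × ℤ) :
    ∫ x in (-π)..π, tripleTerm a b t θ₀ p x =
      if p.2 = p.1.2 - p.1.1 then (starRingEnd ℂ) (a p.1.1) * b p.1.2 *
        Complex.exp (-Complex.I * ((p.1.2 - p.1.1 : ℤ) : ℂ) * θ₀ -
          ((p.1.2 - p.1.1 : ℤ) : ℂ) ^ 2 * (t / 2 : ℝ)) else 0 := by
  obtain ⟨⟨m, n⟩, k⟩ := p
  simp only [tripleTerm, Complex.exp_add]
  rw [intervalIntegral.integral_const_mul, intervalIntegral.integral_mul_const,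
    integral_cexp_int_mul]
  by_cases hk : k = n - m
  · have hπ : (π : ℂ) ≠ 0 := by exact_mod_cast pi_ne_zero
    rw [if_pos (by omega), if_pos hk, hk]
    have : ∀ z w v : ℂ, ((1 / (2 * π) : ℝ) : ℂ) * z * (2 * π * w) = z * w := by
      intro z w v
      push_cast
      field_simp
    rw [this _ _ 0]
    congr 2
    push_cast
    ring
  · rw [if_neg (by omega), if_neg hk]
    simp

theorem tsum_integral_tripleTerm_eq {f g : ℝ → ℂ} (hf : Continuous f) (hg : Continuous g)
    (hfper : ∀ θ : ℝ, f (θ + 2 * π) = f θ) (hgper : ∀ θ : ℝ, g (θ + 2 * π) = g θ) {t : ℝ}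
    (ht : 0 < t) (θ₀ : ℝ) {L : ℂ}
    (hL : HasSum (fun p => ∫ x in (-π)..π,
      tripleTerm (circleCoeff f) (circleCoeff g) t θ₀ p x) L) :
    L = ((1 / (2 * π) : ℝ) : ℂ) * ∫ θ in (-π)..π, (starRingEnd ℂ) (f θ) * g θ *
        ∑' m : ℤ, Complex.exp (Complex.I * (m : ℂ) * ((θ : ℂ) - (θ₀ : ℂ)) -
          (m : ℂ) ^ 2 * ((t / 2 : ℝ) : ℂ)) := by
  simp_rw [integral_tripleTerm] at hL
  have h1 := hL.prod_fiberwise (g := fun q => (starRingEnd ℂ) (circleCoeff f q.1) *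
      circleCoeff g q.2 * Complex.exp (-Complex.I * ((q.2 - q.1 : ℤ) : ℂ) * θ₀ -
          ((q.2 - q.1 : ℤ) : ℂ) ^ 2 * (t / 2 : ℝ))) fun q => hasSum_ite_eq (q.2 - q.1) _
  have h2 := (Equiv.prodComm ℤ ℤ).hasSum_iff.2 (intShear.hasSum_iff.2 h1)
  have h3 := h2.prod_fiberwise (g := fun j => circleCoeff (fun θ => (starRingEnd ℂ) (f θ) * g θ) j *
      Complex.exp (-Complex.I * (j : ℂ) * θ₀ - (j : ℂ) ^ 2 * (t / 2 : ℝ))) fun j => by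
    refine ((hasSum_conj_circleCoeff_mul_shift hf hg hfper hgper j).mul_right _).congr_fun
      fun m => ?_
    simp
  exact h3.unique (hasSum_sum_mul_cexp_circleCoeff (h := fun θ => (starRingEnd ℂ) (f θ) * g θ)
    (by fun_prop) (by positivity) θ₀)

theorem integral_tsum_eq_tsum_tripleTerm {a b : ℤ → ℂ} (ha : Summable fun m => ‖a m‖ ^ 2)
    (hb : Summable fun m => ‖b m‖ ^ 2) {t : ℝ} (ht : 0 < t) (θ₀ x : ℝ) :
    ∫ y : ℝ, ∑' p : (ℤ × ℤ) × ℤ, tripleTerm a b t θ₀ p x *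
        ((1 / √(π * t) * Real.exp (-((p.1.1 + p.1.2 : ℤ) : ℝ) ^ 2 * t / 4) *
          Real.exp (((p.1.1 + p.1.2 : ℤ) : ℝ) * y - y ^ 2 / t) : ℝ) : ℂ) =
      ∑' p, tripleTerm a b t θ₀ p x := by
  have hs : √(π * t) ≠ 0 := by positivity
  have hone : ∀ s : ℝ, ∫ y : ℝ, 1 / √(π * t) * Real.exp (-s ^ 2 * t / 4) *
      Real.exp (s * y - y ^ 2 / t) = 1 := by
    intro s
    rw [integral_const_mul, (integral_exp_mul_sub_sq_div ht s).2, mul_mul_mul_comm,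
      one_div_mul_cancel hs, ← Real.exp_add]
    ring_nf
    exact Real.exp_zero
  have key := hasSum_integral_of_summable_integral_norm (μ := (volume : Measure ℝ))
    (F := fun (p : (ℤ × ℤ) × ℤ) (y : ℝ) => tripleTerm a b t θ₀ p x *
        ((1 / √(π * t) * Real.exp (-((p.1.1 + p.1.2 : ℤ) : ℝ) ^ 2 * t / 4) *
          Real.exp (((p.1.1 + p.1.2 : ℤ) : ℝ) * y - y ^ 2 / t) : ℝ) : ℂ))
    (fun p => (((integral_exp_mul_sub_sq_div ht _).1.const_mul _).ofReal).const_mul _) ?_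
  · rw [← key.tsum_eq]
    congr 1
    ext p
    rw [integral_const_mul, integral_complex_ofReal, hone, Complex.ofReal_one, mul_one]
  · refine ((summable_tripleTerm_bound ha hb ht).of_norm_bounded
      fun p => (norm_norm _).trans_le (norm_tripleTerm_le a b t θ₀ p x)).congr fun p => ?_
    have : ∀ y : ℝ, ‖tripleTerm a b t θ₀ p x *
        ((1 / √(π * t) * Real.exp (-((p.1.1 + p.1.2 : ℤ) : ℝ) ^ 2 * t / 4) *
          Real.exp (((p.1.1 + p.1.2 : ℤ) : ℝ) * y - y ^ 2 / t) : ℝ) : ℂ)‖ =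
        ‖tripleTerm a b t θ₀ p x‖ *
        (1 / √(π * t) * Real.exp (-((p.1.1 + p.1.2 : ℤ) : ℝ) ^ 2 * t / 4) *
          Real.exp (((p.1.1 + p.1.2 : ℤ) : ℝ) * y - y ^ 2 / t)) := fun y => by
      rw [norm_mul, Complex.norm_real, Real.norm_of_nonneg (by positivity)]
    simp_rw [this]
    rw [integral_const_mul, hone, mul_one]

theorem tripleTerm_mul_gaussian (a b : ℤ → ℂ) (t θ₀ x y : ℝ) (m n k : ℤ) :
    tripleTerm a b t θ₀ ((m, n), k) x *
        ((1 / √(π * t) * Real.exp (-((m + n : ℤ) : ℝ) ^ 2 * t / 4) *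
          Real.exp (((m + n : ℤ) : ℝ) * y - y ^ 2 / t) : ℝ) : ℂ) =
      (starRingEnd ℂ) (a m * Complex.exp (-Complex.I * (m : ℂ) * ((x : ℂ) + Complex.I * (y : ℂ)) -
          (m : ℂ) ^ 2 * ((t / 2 : ℝ) : ℂ))) *
        (b n * Complex.exp (-Complex.I * (n : ℂ) * ((x : ℂ) + Complex.I * (y : ℂ)) -
          (n : ℂ) ^ 2 * ((t / 2 : ℝ) : ℂ))) *
        (((1 / (2 * π * Real.sqrt (π * t)) * Real.exp (-y ^ 2 / t) : ℝ) : ℂ) *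
          Complex.exp (Complex.I * (k : ℂ) * ((x - θ₀ : ℝ) : ℂ) -
            (k : ℂ) ^ 2 * ((t / 4 : ℝ) : ℂ))) := by
  have hexp : Complex.exp (Complex.I * ((m - n + k : ℤ) : ℂ) * (x : ℂ) +
      (-((m : ℂ) - n) ^ 2 * (t / 4 : ℝ) - (k : ℂ) ^ 2 * (t / 4 : ℝ) -
        Complex.I * (k : ℂ) * (θ₀ : ℂ))) *
      Complex.exp ((-((m + n : ℤ) : ℝ) ^ 2 * t / 4 : ℝ) : ℂ) *
      Complex.exp ((((m + n : ℤ) : ℝ) * y - y ^ 2 / t : ℝ) : ℂ) =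
      Complex.exp ((starRingEnd ℂ) (-Complex.I * (m : ℂ) * ((x : ℂ) + Complex.I * (y : ℂ)) -
          (m : ℂ) ^ 2 * ((t / 2 : ℝ) : ℂ))) *
      Complex.exp (-Complex.I * (n : ℂ) * ((x : ℂ) + Complex.I * (y : ℂ)) -
          (n : ℂ) ^ 2 * ((t / 2 : ℝ) : ℂ)) *
      Complex.exp ((-y ^ 2 / t : ℝ) : ℂ) *
      Complex.exp (Complex.I * (k : ℂ) * ((x - θ₀ : ℝ) : ℂ) -
            (k : ℂ) ^ 2 * ((t / 4 : ℝ) : ℂ)) := by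
    simp only [← Complex.exp_add, map_sub, map_mul, map_neg, map_add, map_pow, Complex.conj_I,
      Complex.conj_ofReal, map_intCast]
    congr 1
    push_cast
    linear_combination ((m : ℂ) * y + (n : ℂ) * y) * Complex.I_sq
  simp only [tripleTerm, map_mul, ← Complex.exp_conj, Complex.ofReal_mul, Complex.ofReal_exp]
  rw [show (1 / (2 * π * √(π * t)) : ℝ) = 1 / (2 * π) * (1 / √(π * t)) by
    rw [one_div_mul_one_div], Complex.ofReal_mul]
  linear_combination (((1 / (2 * π) : ℝ) : ℂ) * ((starRingEnd ℂ) (a m) * b n) *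
    ((1 / √(π * t) : ℝ) : ℂ)) * hexp

theorem hasSum_mul_prod {ι κ : Type*} {A : ι → ℂ} {B : κ → ℂ} {u v : ℂ}
    (hA : HasSum A u) (hB : HasSum B v) : HasSum (fun p : ι × κ => A p.1 * B p.2) (u * v) :=
  hA.mul hB (summable_mul_of_summable_norm hA.summable.norm hB.summable.norm)

theorem conj_mul_mul_eq_tsum {ι κ τ : Type*} {A : ι → ℂ} {B : κ → ℂ} {C : τ → ℂ} {u v w : ℂ}
    (hA : HasSum A u) (hB : HasSum B v) (hC : HasSum C w) :
    (starRingEnd ℂ) u * v * w =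
      ∑' p : (ι × κ) × τ, (starRingEnd ℂ) (A p.1.1) * B p.1.2 * C p.2 := by
  have hA' : HasSum (fun i => (starRingEnd ℂ) (A i)) ((starRingEnd ℂ) u) :=
    hA.map (starRingEnd ℂ) Complex.continuous_conj
  exact (hasSum_mul_prod (hasSum_mul_prod hA' hB) hC).tsum_eq.symm

theorem conj_mul_mul_eq_tsum_tripleTerm {a b : ℤ → ℂ} {t θ₀ x y : ℝ} {u v w : ℂ}
    (hu : HasSum (fun m : ℤ => a m *
      Complex.exp (-Complex.I * (m : ℂ) * ((x : ℂ) + Complex.I * (y : ℂ)) -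
        (m : ℂ) ^ 2 * ((t / 2 : ℝ) : ℂ))) u)
    (hv : HasSum (fun m : ℤ => b m *
      Complex.exp (-Complex.I * (m : ℂ) * ((x : ℂ) + Complex.I * (y : ℂ)) -
        (m : ℂ) ^ 2 * ((t / 2 : ℝ) : ℂ))) v)
    (hw : HasSum (fun k : ℤ =>
      ((1 / (2 * π * Real.sqrt (π * t)) * Real.exp (-y ^ 2 / t) : ℝ) : ℂ) *
        Complex.exp (Complex.I * (k : ℂ) * ((x - θ₀ : ℝ) : ℂ) -
          (k : ℂ) ^ 2 * ((t / 4 : ℝ) : ℂ))) w) :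
    (starRingEnd ℂ) u * v * w =
      ∑' p : (ℤ × ℤ) × ℤ, tripleTerm a b t θ₀ p x *
        ((1 / √(π * t) * Real.exp (-((p.1.1 + p.1.2 : ℤ) : ℝ) ^ 2 * t / 4) *
          Real.exp (((p.1.1 + p.1.2 : ℤ) : ℝ) * y - y ^ 2 / t) : ℝ) : ℂ) := by
  rw [conj_mul_mul_eq_tsum hu hv hw]
  exact tsum_congr fun p => (tripleTerm_mul_gaussian a b t θ₀ x y p.1.1 p.1.2 p.2).symm

/-- Isometry of the Segal–Bargmann transform on the circle: with
`ψ = A_t f`, `φ = A_t g`, where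
`A_t h(x+iy) = (1/2π) ∫_{−π}^{π} h(θ) Σₙ e^{in(θ−x−iy) − n²t/2} dθ`, one has
`∫_{−π}^{π} ∫_ℝ conj(ψ) φ ν dy dx = ∫_{−π}^{π} conj(f) g ρ_t^{θ₀} dθ`, where
`ν(x,y) = (1/(2π√(πt))) e^{−y²/t} Σₙ e^{in(x−θ₀) − n²t/4}` is the cylinder heat kernel
at time `t/2` and `ρ_t^{θ₀}(θ) = (1/2π) Σₖ e^{ik(θ−θ₀) − k²t/2}`. -/
theorem segalBargmann_circle_isometry (f g : ℝ → ℂ) (hf : Continuous f)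
    (hg : Continuous g) (hfper : ∀ θ : ℝ, f (θ + 2 * π) = f θ)
    (hgper : ∀ θ : ℝ, g (θ + 2 * π) = g θ) (t : ℝ) (ht : 0 < t) (θ₀ : ℝ) :
    let At : (ℝ → ℂ) → ℂ → ℂ := fun h z =>
      ((1 / (2 * π) : ℝ) : ℂ) * ∫ θ in (-π)..π, h θ *
        ∑' m : ℤ, Complex.exp (Complex.I * (m : ℂ) * ((θ : ℂ) - z) - (m : ℂ) ^ 2 * (t : ℂ) / 2)
    let ν : ℝ → ℝ → ℂ := fun x y =>
      ((1 / (2 * π * Real.sqrt (π * t)) * Real.exp (-y ^ 2 / t) : ℝ) : ℂ) *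
        ∑' m : ℤ, Complex.exp (Complex.I * (m : ℂ) * ((x - θ₀ : ℝ) : ℂ) - (m : ℂ) ^ 2 * (t : ℂ) / 4)
    let ρ : ℝ → ℂ := fun θ =>
      ((1 / (2 * π) : ℝ) : ℂ) *
        ∑' k : ℤ, Complex.exp (Complex.I * (k : ℂ) * ((θ - θ₀ : ℝ) : ℂ) - (k : ℂ) ^ 2 * (t : ℂ) / 2)
    ∫ x in (-π)..π, ∫ y : ℝ,
        (starRingEnd ℂ) (At f ((x : ℂ) + Complex.I * (y : ℂ))) *
          At g ((x : ℂ) + Complex.I * (y : ℂ)) * ν x y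
      = ∫ θ in (-π)..π, (starRingEnd ℂ) (f θ) * g θ * ρ θ := by
  have hid : ∀ c : ℂ, c * t / 2 = c * ((t / 2 : ℝ) : ℂ) := fun c => by push_cast; ring
  have hid' : ∀ c : ℂ, c * t / 4 = c * ((t / 4 : ℝ) : ℂ) := fun c => by push_cast; ring
  intro At ν ρ
  have ha := summable_norm_sq_circleCoeff hf hfper
  have hb := summable_norm_sq_circleCoeff hg hgper
  have hAt : ∀ {h : ℝ → ℂ}, Continuous h → ∀ z : ℂ, HasSum (fun m : ℤ => circleCoeff h m *
      Complex.exp (-Complex.I * (m : ℂ) * z - (m : ℂ) ^ 2 * ((t / 2 : ℝ) : ℂ))) (At h z) := by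
    intro h hh z
    simp only [At, hid]
    exact hasSum_sum_mul_cexp_circleCoeff hh (by positivity) z
  have hexpand : ∀ x y : ℝ, (starRingEnd ℂ) (At f ((x : ℂ) + Complex.I * (y : ℂ))) *
      At g ((x : ℂ) + Complex.I * (y : ℂ)) * ν x y =
      ∑' p : (ℤ × ℤ) × ℤ, tripleTerm (circleCoeff f) (circleCoeff g) t θ₀ p x *
        ((1 / √(π * t) * Real.exp (-((p.1.1 + p.1.2 : ℤ) : ℝ) ^ 2 * t / 4) *
          Real.exp (((p.1.1 + p.1.2 : ℤ) : ℝ) * y - y ^ 2 / t) : ℝ) : ℂ) := by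
    intro x y
    have hν : HasSum (fun k : ℤ =>
        ((1 / (2 * π * Real.sqrt (π * t)) * Real.exp (-y ^ 2 / t) : ℝ) : ℂ) *
          Complex.exp (Complex.I * (k : ℂ) * ((x - θ₀ : ℝ) : ℂ) -
            (k : ℂ) ^ 2 * ((t / 4 : ℝ) : ℂ))) (ν x y) := by
      simp only [ν, hid']
      exact (summable_norm_cexp_theta (by positivity) _).of_norm.hasSum.mul_left _
    exact conj_mul_mul_eq_tsum_tripleTerm (hAt hf _) (hAt hg _) hν
  have hint : ∀ x : ℝ, ∫ y : ℝ, (starRingEnd ℂ) (At f ((x : ℂ) + Complex.I * (y : ℂ))) *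
      At g ((x : ℂ) + Complex.I * (y : ℂ)) * ν x y =
      ∑' p, tripleTerm (circleCoeff f) (circleCoeff g) t θ₀ p x := by
    intro x
    simp_rw [hexpand]
    exact integral_tsum_eq_tsum_tripleTerm ha hb ht θ₀ x
  simp_rw [hint]
  have hL := hasSum_intervalIntegral_of_norm_le (a := -π) (b := π)
    (F := fun p => tripleTerm (circleCoeff f) (circleCoeff g) t θ₀ p)
    (fun p => by unfold tripleTerm; fun_prop)
    (fun p x _ => norm_tripleTerm_le _ _ t θ₀ p x) (summable_tripleTerm_bound ha hb ht)
  rw [tsum_integral_tripleTerm_eq hf hg hfper hgper ht θ₀ hL, ← intervalIntegral.integral_const_mul]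
  congr 1
  ext θ
  simp only [ρ, hid, Complex.ofReal_sub]
  ring
end

section
/- Let φ : ℂ → ℂ be an entire function with ∫_ℂ |φ(w)|² e^{−|w|²} dA(w) < ∞, where dA is the Lebesgue (area) measure on ℂ. Then for every z ∈ ℂ, z·φ'(z) = (1/π) ∫_ℂ z·conj(w) e^{z·conj(w)} φ(w) e^{−|w|²} dA(w). -/
open Real MeasureTheory

/-- The integral of a function over the plane is the integral of its averages over circles centred
at the origin. -/
theorem integral_circleAverage_norm {E : Type*} [NormedAddCommGroup E] [NormedSpace ℝ E]
    [CompleteSpace E]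
    {F : ℂ → E} (hF : Continuous F) (hint : Integrable F) :
    ∫ u : ℂ, circleAverage F 0 ‖u‖ = ∫ u, F u := by
  have hmp (θ : ℝ) : MeasurePreserving (rotation (Circle.exp θ)) volume volume :=
    (rotation (Circle.exp θ)).measurePreserving
  have hcont : Continuous (Function.uncurry fun (θ : ℝ) (u : ℂ) => F (Circle.exp θ * u)) := by
    unfold Function.uncurry
    fun_prop
  have hprod : Integrable (Function.uncurry fun (θ : ℝ) (u : ℂ) => F (Circle.exp θ * u))
      ((volume.restrict (Set.uIoc 0 (2 * π))).prod volume) := by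
    rw [integrable_prod_iff hcont.aestronglyMeasurable]
    refine ⟨.of_forall fun θ => (hmp θ).integrable_comp_of_integrable hint, ?_⟩
    have h (θ : ℝ) : ∫ u, ‖F (Circle.exp θ * u)‖ = ∫ u, ‖F u‖ :=
      (hmp θ).integral_comp (rotation (Circle.exp θ)).toHomeomorph.measurableEmbedding
        fun u => ‖F u‖
    simp only [Function.uncurry, h]
    have : IsFiniteMeasure (volume.restrict (Set.uIoc 0 (2 * π))) := by
      rw [Set.uIoc]; infer_instance
    exact integrable_const _
  have hrot (θ : ℝ) : ∫ u, F (Circle.exp θ * u) = ∫ u, F u :=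
    (hmp θ).integral_comp (rotation (Circle.exp θ)).toHomeomorph.measurableEmbedding F
  have havg (u : ℂ) :
      circleAverage F 0 ‖u‖ = (2 * π)⁻¹ • ∫ θ in 0..2 * π, F (Circle.exp θ * u) := by
    rw [circleAverage_eq_integral_add u.arg]
    congr! 4 with θ
    nth_rw 3 [← Complex.norm_mul_exp_arg_mul_I u]
    simp only [circleMap, Circle.coe_exp, Complex.ofReal_add, add_mul, Complex.exp_add]
    ring
  simp_rw [havg]
  rw [integral_smul, ← intervalIntegral_integral_swap hprod]
  simp only [hrot, intervalIntegral.integral_const, sub_zero, smul_smul]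
  rw [inv_mul_cancel₀ (by positivity), one_smul]

theorem circleAverage_conj_mul_of_differentiable {g : ℂ → ℂ} (hg : Differentiable ℂ g) {r : ℝ}
    (hr : 0 ≤ r) :
    circleAverage (fun u => (starRingEnd ℂ) u * g u) 0 r = (r : ℂ) ^ 2 * deriv g 0 := by
  rcases hr.eq_or_lt with rfl | hr
  · simp
  rw [circleAverage_eq_circleIntegral hr.ne',
    ← Complex.two_pi_I_inv_smul_circleIntegral_sub_sq_inv_smul_of_differentiable isOpen_univ
      (Set.subset_univ (Metric.closedBall (0 : ℂ) r)) hg.differentiableOn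
      (Metric.mem_ball_self hr), smul_eq_mul, smul_eq_mul, mul_left_comm,
    ← circleIntegral.integral_const_mul ((r : ℂ) ^ 2)]
  congr 1
  refine circleIntegral.integral_congr hr.le fun u hu => ?_
  have hu' : ‖u‖ = r := by simpa using hu
  have hu0 : u ≠ 0 := by rw [← norm_pos_iff, hu']; exact hr
  have := Complex.mul_conj' u
  rw [hu'] at this
  simp only [sub_zero, smul_eq_mul]
  field_simp
  rw [← this]
  ring

theorem Complex.integral_exp_neg_norm_sq : ∫ u : ℂ, rexp (-‖u‖ ^ 2) = π := by
  have h := Complex.integral_exp_neg_rpow (p := 2) (by norm_num)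
  simp only [Real.rpow_two] at h
  rw [h, div_self two_ne_zero, Real.Gamma_add_one one_ne_zero, Real.Gamma_one]
  ring

theorem Complex.integral_norm_sq_mul_exp_neg_norm_sq :
    ∫ u : ℂ, ‖u‖ ^ 2 * rexp (-‖u‖ ^ 2) = π := by
  have h := Complex.integral_rpow_mul_exp_neg_rpow (p := 2) (q := 2) (by norm_num) (by norm_num)
  simp only [Real.rpow_two] at h
  rw [h, show ((2 : ℝ) + 2) / 2 = 1 + 1 by norm_num, Real.Gamma_add_one one_ne_zero,
    Real.Gamma_one]
  ring

theorem Complex.integrable_exp_neg_norm_sq : Integrable fun u : ℂ => rexp (-‖u‖ ^ 2) :=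
  .of_integral_ne_zero (by rw [Complex.integral_exp_neg_norm_sq]; exact pi_ne_zero)

theorem Complex.integrable_norm_sq_mul_exp_neg_norm_sq :
    Integrable fun u : ℂ => ‖u‖ ^ 2 * rexp (-‖u‖ ^ 2) :=
  .of_integral_ne_zero (by
    rw [Complex.integral_norm_sq_mul_exp_neg_norm_sq]; exact pi_ne_zero)

/-- Integrating `conj (a + u)` times an entire function `g` against the Gaussian weight only sees
the first two Taylor coefficients of `g` at the origin. -/
theorem integral_conj_add_mul_gaussian_of_differentiable {g : ℂ → ℂ} (hg : Differentiable ℂ g) (a : ℂ)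
    (hint : Integrable fun u : ℂ => (starRingEnd ℂ) (a + u) * g u * (rexp (-‖u‖ ^ 2) : ℝ)) :
    ∫ u : ℂ, (starRingEnd ℂ) (a + u) * g u * (rexp (-‖u‖ ^ 2) : ℝ) =
      π * ((starRingEnd ℂ) a * g 0 + deriv g 0) := by
  have hgc := hg.continuous
  have havg (u : ℂ) :
      circleAverage (fun u : ℂ => (starRingEnd ℂ) (a + u) * g u * (rexp (-‖u‖ ^ 2) : ℝ)) 0 ‖u‖ =
        (starRingEnd ℂ) a * g 0 * (rexp (-‖u‖ ^ 2) : ℝ) +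
          deriv g 0 * ((‖u‖ ^ 2 * rexp (-‖u‖ ^ 2) : ℝ) : ℂ) := by
    set c : ℂ := ((rexp (-‖u‖ ^ 2) : ℝ) : ℂ) with hc
    have hcongr :
        circleAverage (fun u : ℂ => (starRingEnd ℂ) (a + u) * g u * (rexp (-‖u‖ ^ 2) : ℝ)) 0 ‖u‖ =
        circleAverage ((c * (starRingEnd ℂ) a) • g +
          c • fun v : ℂ => (starRingEnd ℂ) v * g v) 0 ‖u‖ := by
      refine circleAverage_congr_sphere fun v hv => ?_
      have hv' : ‖v‖ = ‖u‖ := by simpa using hv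
      simp only [hv', ← hc, map_add, Pi.add_apply, Pi.smul_apply, smul_eq_mul]
      ring
    rw [hcongr, circleAverage_add, circleAverage_smul, circleAverage_smul,
      hg.diffContOnCl.circleAverage, circleAverage_conj_mul_of_differentiable hg (norm_nonneg u)]
    · simp only [smul_eq_mul, Complex.ofReal_mul, Complex.ofReal_pow, ← hc]
      ring
    · exact (hgc.const_smul _).continuousOn.circleIntegrable (norm_nonneg u)
    · exact ContinuousOn.circleIntegrable (norm_nonneg u) (Continuous.continuousOn (by fun_prop))
  rw [← integral_circleAverage_norm (by fun_prop) hint]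
  simp_rw [havg]
  rw [integral_add (Complex.integrable_exp_neg_norm_sq.ofReal.const_mul _)
      (Complex.integrable_norm_sq_mul_exp_neg_norm_sq.ofReal.const_mul _),
    integral_const_mul, integral_const_mul, integral_complex_ofReal, integral_complex_ofReal,
    Complex.integral_exp_neg_norm_sq, Complex.integral_norm_sq_mul_exp_neg_norm_sq]
  ring

theorem integrable_conj_add_mul_exp_mul_gaussian {φ : ℂ → ℂ} (hφ : Continuous φ)
    (hint : Integrable (fun w : ℂ => ‖φ w‖ ^ 2 * Real.exp (-‖w‖ ^ 2))) (z : ℂ) :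
    Integrable fun u : ℂ => (starRingEnd ℂ) (z + u) *
      (Complex.exp (-((starRingEnd ℂ) z * u)) * φ (z + u)) * (rexp (-‖u‖ ^ 2) : ℝ) := by
  have h1 : Integrable fun u : ℂ => ‖φ (z + u)‖ ^ 2 * rexp (-‖z + u‖ ^ 2) :=
    hint.comp_add_left z
  have h2 : Integrable fun u : ℂ => rexp (‖z‖ ^ 2) *
      (2 * ‖z‖ ^ 2 * rexp (-‖u‖ ^ 2) + 2 * (‖u‖ ^ 2 * rexp (-‖u‖ ^ 2))) :=
    ((Complex.integrable_exp_neg_norm_sq.const_mul _).add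
      (Complex.integrable_norm_sq_mul_exp_neg_norm_sq.const_mul _)).const_mul _
  refine (h1.add h2).mono' (Continuous.aestronglyMeasurable (by fun_prop))
    (.of_forall fun u => ?_)
  have hsq : ‖z + u‖ ^ 2 = ‖z‖ ^ 2 + ‖u‖ ^ 2 + 2 * ((starRingEnd ℂ) z * u).re := by
    rw [Complex.sq_norm, Complex.sq_norm, Complex.sq_norm, Complex.normSq_add]
    simp
  have htri : ‖z + u‖ ^ 2 ≤ 2 * ‖z‖ ^ 2 + 2 * ‖u‖ ^ 2 := by
    have := norm_add_le z u
    nlinarith [sq_nonneg (‖z‖ - ‖u‖), norm_nonneg (z + u)]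
  have hexp : rexp (-((starRingEnd ℂ) z * u).re) * rexp (-‖u‖ ^ 2) =
      rexp (-‖z + u‖ ^ 2 / 2) * rexp ((‖z‖ ^ 2 - ‖u‖ ^ 2) / 2) := by
    rw [← Real.exp_add, ← Real.exp_add, hsq]
    ring_nf
  have hA : rexp (-‖z + u‖ ^ 2) = rexp (-‖z + u‖ ^ 2 / 2) ^ 2 := by
    rw [← Real.exp_nat_mul]; ring_nf
  have hB : rexp (‖z‖ ^ 2) * rexp (-‖u‖ ^ 2) = rexp ((‖z‖ ^ 2 - ‖u‖ ^ 2) / 2) ^ 2 := by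
    rw [← Real.exp_nat_mul, ← Real.exp_add]; ring_nf
  set A := rexp (-‖z + u‖ ^ 2 / 2)
  set B := rexp ((‖z‖ ^ 2 - ‖u‖ ^ 2) / 2)
  calc ‖(starRingEnd ℂ) (z + u) * (Complex.exp (-((starRingEnd ℂ) z * u)) * φ (z + u)) *
        (rexp (-‖u‖ ^ 2) : ℝ)‖
      = ‖z + u‖ * ‖φ (z + u)‖ *
          (rexp (-((starRingEnd ℂ) z * u).re) * rexp (-‖u‖ ^ 2)) := by
        rw [norm_mul, norm_mul, norm_mul, RCLike.norm_conj, Complex.norm_exp, Complex.norm_real,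
          Real.norm_of_nonneg (Real.exp_pos _).le, Complex.neg_re]
        ring
    _ = (‖φ (z + u)‖ * A) * (‖z + u‖ * B) := by rw [hexp]; ring
    _ ≤ (‖φ (z + u)‖ * A) ^ 2 + (‖z + u‖ * B) ^ 2 := by
        nlinarith [sq_nonneg (‖φ (z + u)‖ * A - ‖z + u‖ * B), sq_nonneg (‖φ (z + u)‖ * A),
          sq_nonneg (‖z + u‖ * B)]
    _ ≤ (‖φ (z + u)‖ * A) ^ 2 + (2 * ‖z‖ ^ 2 + 2 * ‖u‖ ^ 2) * B ^ 2 := by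
        rw [mul_pow _ B]
        gcongr
    _ = _ := by
        simp only [Pi.add_apply]
        rw [hA, ← hB]
        ring

/-- The operator `H = z d/dz` on the Segal–Bargmann space (Gaussian
weight `e^{−|w|²}`) is represented by the integral kernel
`K_H(z, conj w) = z·conj(w) e^{z·conj(w)}`:
`z φ'(z) = (1/π) ∫_ℂ z·conj(w) e^{z·conj(w)} φ(w) e^{−|w|²} dA(w)`. -/
theorem segalBargmann_harmonicOscillator_kernel (φ : ℂ → ℂ)
    (hφ : Differentiable ℂ φ)
    (hint : Integrable (fun w : ℂ => ‖φ w‖ ^ 2 * Real.exp (-‖w‖ ^ 2))) :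
    ∀ z : ℂ, z * deriv φ z = ((1 / π : ℝ) : ℂ) *
      ∫ w : ℂ, z * (starRingEnd ℂ) w * Complex.exp (z * (starRingEnd ℂ) w) * φ w *
        ((Real.exp (-‖w‖ ^ 2) : ℝ) : ℂ) := by
  intro z
  set g : ℂ → ℂ := fun u => Complex.exp (-((starRingEnd ℂ) z * u)) * φ (z + u) with hg_def
  have hg : Differentiable ℂ g := by fun_prop
  have hderiv : deriv g 0 = deriv φ z - (starRingEnd ℂ) z * φ z := by
    have h1 : HasDerivAt (fun u : ℂ => Complex.exp (-((starRingEnd ℂ) z * u)))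
        (-(starRingEnd ℂ) z) 0 := by
      simpa using (((hasDerivAt_id (0 : ℂ)).const_mul ((starRingEnd ℂ) z)).neg).cexp
    have h2 : HasDerivAt (fun u : ℂ => φ (z + u)) (deriv φ z) 0 :=
      HasDerivAt.comp_const_add z 0 (by simpa using (hφ z).hasDerivAt)
    refine (h1.mul h2).deriv.trans ?_
    simp
    ring
  have hkey := integral_conj_add_mul_gaussian_of_differentiable hg z
    (integrable_conj_add_mul_exp_mul_gaussian hφ.continuous hint z)
  have hshift (u : ℂ) : z * (starRingEnd ℂ) (z + u) * Complex.exp (z * (starRingEnd ℂ) (z + u)) *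
      φ (z + u) * (rexp (-‖z + u‖ ^ 2) : ℝ) =
      z * ((starRingEnd ℂ) (z + u) * g u * (rexp (-‖u‖ ^ 2) : ℝ)) := by
    have hexp : Complex.exp (z * (starRingEnd ℂ) (z + u)) * (rexp (-‖z + u‖ ^ 2) : ℝ) =
        Complex.exp (-((starRingEnd ℂ) z * u)) * (rexp (-‖u‖ ^ 2) : ℝ) := by
      push_cast
      rw [← Complex.exp_add, ← Complex.exp_add, ← Complex.mul_conj', ← Complex.mul_conj', map_add]
      ring_nf
    simp only [hg_def]
    linear_combination z * (starRingEnd ℂ) (z + u) * φ (z + u) * hexp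
  rw [← integral_add_left_eq_self _ z]
  simp_rw [hshift]
  rw [integral_const_mul, hkey, hderiv]
  have hpi : (π : ℂ) ≠ 0 := Complex.ofReal_ne_zero.mpr pi_ne_zero
  simp only [hg_def, mul_zero, neg_zero, Complex.exp_zero, add_zero, one_mul]
  push_cast
  field_simp
  ring
end
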